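/- Let p be a prime, n a positive integer, and q an integer coprime to p whose residue class generates the multiplicative group of units of ZMod (p^n). Then every vertex of the exponentiation graph Γ_{p,n,q} has out-degree exactly p-1; that is, for every x ∈ ℤ, the set O^n(x) = { w ∈ ZMod (p^n) : ∃ y ∈ ℕ, y ≡ x (mod p^n) and w ≡ q^y (mod p^n) } has cardinality p-1. -/

import Mathlib

/-- The set of out-neighbors of `x` in the exponentiation graph modulo `p^n`:
residues modulo `p^n` of `q^y` over all natural numbers `y ≡ x (mod p^n)`. -/
def outNbrs (p n : ℕ) (q x : ℤ) : Set (ZMod (p ^ n)) :=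
  {w | ∃ y : ℕ, ((y : ℤ) : ZMod (p ^ n)) = (x : ZMod (p ^ n)) ∧ (q : ZMod (p ^ n)) ^ y = w}

theorem orderOf_pow_prime_pow_of_orderOf_eq_totient {G : Type*} [Monoid G] {p n : ℕ}
    (hp : p.Prime) (hn : 0 < n) {u : G} (hu : orderOf u = (p ^ n).totient) :
    orderOf (u ^ p ^ n) = p - 1 := by
  obtain ⟨k, rfl⟩ : ∃ k, n = k + 1 := ⟨n - 1, by omega⟩
  have hcop : Nat.Coprime (p - 1) p :=
    (Nat.coprime_self_sub_left hp.one_le).2 (Nat.coprime_one_left p)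
  have hgcd : Nat.gcd (p ^ k * (p - 1)) (p ^ (k + 1)) = p ^ k := by
    rw [pow_succ, Nat.gcd_mul_left, hcop.gcd_eq_one, mul_one]
  rw [orderOf_pow' u (pow_pos hp.pos _).ne', hu, Nat.totient_prime_pow_succ hp, hgcd,
    Nat.mul_div_cancel_left _ (pow_pos hp.pos k)]

theorem outNbrs_eq_image_zpowers {p n : ℕ} [NeZero (p ^ n)] {q : ℤ} (u : (ZMod (p ^ n))ˣ)
    (hu : (u : ZMod (p ^ n)) = q) (x : ℤ) :
    outNbrs p n q x =
      (fun v : (ZMod (p ^ n))ˣ => ((u ^ (x : ZMod (p ^ n)).val * v : (ZMod (p ^ n))ˣ) :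
        ZMod (p ^ n))) '' (Subgroup.zpowers (u ^ p ^ n) : Set (ZMod (p ^ n))ˣ) := by
  ext w
  constructor
  · rintro ⟨y, hy, rfl⟩
    refine ⟨(u ^ p ^ n) ^ (y / p ^ n), Subgroup.npow_mem_zpowers _ _, ?_⟩
    have hval : (x : ZMod (p ^ n)).val = y % p ^ n := by
      rw [← hy, Int.cast_natCast, ZMod.val_natCast]
    simp only [hval, ← pow_mul, ← pow_add, Nat.mod_add_div, Units.val_pow_eq_pow_val, hu]
  · rintro ⟨v, hv, rfl⟩
    obtain ⟨k, rfl⟩ := mem_powers_iff_mem_zpowers.2 hv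
    refine ⟨(x : ZMod (p ^ n)).val + p ^ n * k, ?_, ?_⟩
    · have h : ((p : ZMod (p ^ n)) ^ n) = 0 := by exact_mod_cast ZMod.natCast_self (p ^ n)
      simp [h]
    · simp [← hu, pow_add, pow_mul]

theorem ncard_outNbrs_of_primitive (p n : ℕ) (q : ℤ) (hp : p.Prime) (hn : 0 < n)
    (hq : IsCoprime q (p : ℤ))
    (hprim : ∀ u : (ZMod (p ^ n))ˣ, ∃ m : ℕ, (q : ZMod (p ^ n)) ^ m = (u : ZMod (p ^ n))) :
    ∀ x : ℤ, (outNbrs p n q x).ncard = p - 1 := by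
  intro x
  have : NeZero (p ^ n) := ⟨(pow_pos hp.pos n).ne'⟩
  have hunit : IsUnit (q : ZMod (p ^ n)) := by
    rw [ZMod.coe_int_isUnit_iff_isCoprime]
    push_cast
    exact hq.symm.pow_left
  obtain ⟨u, hu⟩ := hunit
  have hord : orderOf u = (p ^ n).totient := by
    rw [← ZMod.card_units_eq_totient, ← Nat.card_eq_fintype_card]
    refine orderOf_eq_card_of_forall_mem_zpowers fun v => ?_
    obtain ⟨m, hm⟩ := hprim v
    exact ⟨m, Units.ext (by simpa [hu] using hm)⟩
  rw [outNbrs_eq_image_zpowers u hu, Set.ncard_image_of_injective _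
    fun v w h => mul_right_injective _ (Units.ext h), ← Nat.card_coe_set_eq]
  exact (Nat.card_zpowers _).trans (orderOf_pow_prime_pow_of_orderOf_eq_totient hp hn hord)
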